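/- Assume Γ is Q-polynomial with respect to E. Then for all vertices x, y ∈ X at distance ∂(x,y) = 1: E x̂ ⋆ E ŷ = [ (θ*_2 − θ*_1) B(x,y) + (θ₂ − θ₀ + θ*_0 − θ*_1)(E x̂ + E ŷ) ] / ( |X| (θ₁ − θ₂) ). -/

import Mathlib

open Matrix Finset
open scoped Classical

/-- A distance-regular graph `Γ` with vertex set `X`, path-length distance
`G.dist`, diameter `d ≥ 2`, and intersection numbers `p h i j`. -/
structure DRG where
  X : Type
  [fin : Fintype X]
  [deceq : DecidableEq X]
  G : SimpleGraph X
  conn : G.Connected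
  d : ℕ
  d_ge_two : 2 ≤ d
  dist_le : ∀ x y : X, G.dist x y ≤ d
  dist_attained : ∃ x y : X, G.dist x y = d
  p : ℕ → ℕ → ℕ → ℕ
  dist_regular : ∀ (h i j : ℕ) (x y : X), G.dist x y = h →
    (Finset.univ.filter fun z => G.dist x z = i ∧ G.dist y z = j).card = p h i j

attribute [instance] DRG.fin DRG.deceq

namespace DRG

variable (Γ : DRG)

/-- `Γ_i(x) = {z : ∂(x,z) = i}`. -/
noncomputable def sphere (x : Γ.X) (i : ℕ) : Finset Γ.X :=
  Finset.univ.filter fun z => Γ.G.dist x z = i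

/-- The number of vertices `|X|`, as a real number. -/
noncomputable def n : ℝ := (Fintype.card Γ.X : ℝ)

/-- The `i`-th distance matrix `A_i`. -/
noncomputable def Ai (i : ℕ) : Matrix Γ.X Γ.X ℝ :=
  Matrix.of fun x y => if Γ.G.dist x y = i then (1 : ℝ) else 0

/-- The adjacency matrix `A = A_1`. -/
noncomputable def A : Matrix Γ.X Γ.X ℝ := Γ.Ai 1

/-- The all-ones matrix `J`. -/
def Jmat : Matrix Γ.X Γ.X ℝ := Matrix.of fun _ _ => (1 : ℝ)

/-- `c_i = p^i_{1,i-1}` (so `c_0 = 0`). -/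
noncomputable def c (i : ℕ) : ℝ := (Γ.p i 1 (i - 1) : ℝ)

/-- `a_i = p^i_{1,i}`. -/
noncomputable def a (i : ℕ) : ℝ := (Γ.p i 1 i : ℝ)

/-- `b_i = p^i_{1,i+1}` (so `b_d = 0`). -/
noncomputable def b (i : ℕ) : ℝ := (Γ.p i 1 (i + 1) : ℝ)

/-- The standard basis vector `x̂`. -/
noncomputable def hatv (x : Γ.X) : Γ.X → ℝ := Pi.single x 1

/-- `x⁺_y = Σ_{z ∈ Γ(x) ∩ Γ_{i+1}(y)} ẑ` where `i = ∂(x,y)`. -/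
noncomputable def plusv (x y : Γ.X) : Γ.X → ℝ :=
  ∑ z ∈ Γ.sphere x 1 ∩ Γ.sphere y (Γ.G.dist x y + 1), Γ.hatv z

/-- `x⁰_y = Σ_{z ∈ Γ(x) ∩ Γ_i(y)} ẑ` where `i = ∂(x,y)`. -/
noncomputable def zerov (x y : Γ.X) : Γ.X → ℝ :=
  ∑ z ∈ Γ.sphere x 1 ∩ Γ.sphere y (Γ.G.dist x y), Γ.hatv z

/-- `x⁻_y = Σ_{z ∈ Γ(x) ∩ Γ_{i-1}(y)} ẑ` where `i = ∂(x,y)`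
(for `i = 0` this is the zero vector, matching `Γ_{-1}(y) = ∅`). -/
noncomputable def minusv (x y : Γ.X) : Γ.X → ℝ :=
  ∑ z ∈ Γ.sphere x 1 ∩ Γ.sphere y (Γ.G.dist x y - 1), Γ.hatv z

/-- The Norton product `u ⋆ v = E (u ∘ v)`, where `∘` is the entrywise
(Hadamard) product of vectors. -/
noncomputable def norton (E : Matrix Γ.X Γ.X ℝ) (u v : Γ.X → ℝ) : Γ.X → ℝ :=
  E *ᵥ (u * v)

/-- `E 0, …, E d` is the sequence of primitive idempotents of the Bose–Mesner
algebra, with `E 0 = |X|⁻¹ J`, and `θ 0, …, θ d` are the corresponding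
(mutually distinct) eigenvalues, so that `A = Σ_i θ i • E i`. -/
def IsPrimIdemSeq (E : ℕ → Matrix Γ.X Γ.X ℝ) (θ : ℕ → ℝ) : Prop :=
  E 0 = (Γ.n)⁻¹ • Γ.Jmat ∧
  ∑ i ∈ Finset.range (Γ.d + 1), E i = 1 ∧
  (∀ i j : ℕ, i ≤ Γ.d → j ≤ Γ.d → E i * E j = if i = j then E i else 0) ∧
  Γ.A = ∑ i ∈ Finset.range (Γ.d + 1), θ i • E i ∧
  (∀ i j : ℕ, i ≤ Γ.d → j ≤ Γ.d → θ i = θ j → i = j)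

/-- `q h i j` are the Krein parameters:
`E i ∘ E j = |X|⁻¹ Σ_h q h i j • E h`, with `∘` the entrywise product. -/
def IsKrein (E : ℕ → Matrix Γ.X Γ.X ℝ) (q : ℕ → ℕ → ℕ → ℝ) : Prop :=
  ∀ i j : ℕ, i ≤ Γ.d → j ≤ Γ.d →
    Matrix.hadamard (E i) (E j) =
      (Γ.n)⁻¹ • ∑ h ∈ Finset.range (Γ.d + 1), q h i j • E h

/-- The ordering `E 1, …, E d` is `Q`-polynomial: for `0 ≤ h,i,j ≤ d`,
`q h i j = 0` if one of `h,i,j` is greater than the sum of the other two, and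
`q h i j ≠ 0` if one of `h,i,j` equals the sum of the other two. -/
def IsQPolynomial (q : ℕ → ℕ → ℕ → ℝ) : Prop :=
  ∀ h i j : ℕ, h ≤ Γ.d → i ≤ Γ.d → j ≤ Γ.d →
    ((i + j < h ∨ h + j < i ∨ h + i < j) → q h i j = 0) ∧
    ((h = i + j ∨ i = h + j ∨ j = h + i) → q h i j ≠ 0)

/-- `ts 0, …, ts d` are the (mutually distinct) dual eigenvalues associated
with `E`, i.e. `E = |X|⁻¹ Σ_i ts i • A i`.  The values `ts (-1)` and
`ts (d+1)` are arbitrary reals (indeterminates). -/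
def IsDualEigs (E : Matrix Γ.X Γ.X ℝ) (ts : ℤ → ℝ) : Prop :=
  E = (Γ.n)⁻¹ • ∑ i ∈ Finset.range (Γ.d + 1), ts i • Γ.Ai i

/-- The dual eigenvalues `ts 0, …, ts d` are mutually distinct. -/
def DualDistinct (ts : ℤ → ℝ) : Prop :=
  ∀ i j : ℕ, i ≤ Γ.d → j ≤ Γ.d → ts i = ts j → i = j

/-- `C(x,y) = E x⁻_y − c_i ((θ*_1 − θ*_{i-1})/(θ*_0 − θ*_i)) E x̂`,
where `i = ∂(x,y)`. -/
noncomputable def Cvec (E : Matrix Γ.X Γ.X ℝ) (ts : ℤ → ℝ) (x y : Γ.X) :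
    Γ.X → ℝ :=
  E *ᵥ Γ.minusv x y -
    (Γ.c (Γ.G.dist x y) *
      ((ts 1 - ts ((Γ.G.dist x y : ℤ) - 1)) / (ts 0 - ts (Γ.G.dist x y)))) •
      (E *ᵥ Γ.hatv x)

/-- `B(x,y) = E x⁺_y − b_i ((θ*_1 − θ*_{i+1})/(θ*_0 − θ*_i)) E x̂`,
where `i = ∂(x,y)`. -/
noncomputable def Bvec (E : Matrix Γ.X Γ.X ℝ) (ts : ℤ → ℝ) (x y : Γ.X) :
    Γ.X → ℝ :=
  E *ᵥ Γ.plusv x y -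
    (Γ.b (Γ.G.dist x y) *
      ((ts 1 - ts ((Γ.G.dist x y : ℤ) + 1)) / (ts 0 - ts (Γ.G.dist x y)))) •
      (E *ᵥ Γ.hatv x)

end DRG

/-- The squares of the triple sums `∑ z, P a z * Q b z * R c z` add up to the sum of the entries of
`P ∘ Q ∘ R`, so these triple sums vanish as soon as that sum does. -/
theorem Matrix.sum_mul_mul_eq_zero_of_isSymm_of_isIdempotentElem {X : Type*} [Fintype X]
    {P Q R : Matrix X X ℝ} (hP : P.IsSymm) (hQ : Q.IsSymm) (hR : R.IsSymm)
    (hP' : IsIdempotentElem P) (hQ' : IsIdempotentElem Q) (hR' : IsIdempotentElem R)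
    (h : ∑ z, ∑ w, P z w * Q z w * R z w = 0) (a b c : X) :
    ∑ z, P a z * Q b z * R c z = 0 := by
  have gram {M : Matrix X X ℝ} (hM : M.IsSymm) (hM' : IsIdempotentElem M) (z w : X) :
      ∑ a, M a z * M a w = M z w := by
    conv_rhs => rw [← hM'.eq, Matrix.mul_apply]
    exact Finset.sum_congr rfl fun a _ => by rw [hM.apply]
  have hsq : ∑ a, ∑ b, ∑ c, (∑ z, P a z * Q b z * R c z) ^ 2 = 0 := by
    rw [← h]
    simp_rw [sq, Finset.sum_mul_sum]
    calc _ = ∑ a, ∑ b, ∑ z, ∑ w, ∑ c, P a z * Q b z * R c z * (P a w * Q b w * R c w) := by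
            refine Finset.sum_congr rfl fun a _ => Finset.sum_congr rfl fun b _ => ?_
            rw [Finset.sum_comm]
            exact Finset.sum_congr rfl fun z _ => Finset.sum_comm
      _ = ∑ a, ∑ z, ∑ w, ∑ b, ∑ c, P a z * Q b z * R c z * (P a w * Q b w * R c w) := by
            refine Finset.sum_congr rfl fun a _ => ?_
            rw [Finset.sum_comm]
            exact Finset.sum_congr rfl fun z _ => Finset.sum_comm
      _ = ∑ z, ∑ w, ∑ a, ∑ b, ∑ c, P a z * Q b z * R c z * (P a w * Q b w * R c w) := by
            rw [Finset.sum_comm]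
            exact Finset.sum_congr rfl fun z _ => Finset.sum_comm
      _ = _ := by
            refine Finset.sum_congr rfl fun z _ => Finset.sum_congr rfl fun w _ => ?_
            rw [← gram hP hP' z w, ← gram hQ hQ' z w, ← gram hR hR' z w]
            rw [Finset.sum_mul_sum, Finset.sum_mul]
            refine Finset.sum_congr rfl fun a _ => ?_
            rw [Finset.sum_mul_sum]
            refine Finset.sum_congr rfl fun b _ => Finset.sum_congr rfl fun c _ => ?_
            ring
  have nonneg (a b c : X) : 0 ≤ (∑ z, P a z * Q b z * R c z) ^ 2 := sq_nonneg _
  have ha := (Finset.sum_eq_zero_iff_of_nonneg fun a _ => Finset.sum_nonneg fun b _ =>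
    Finset.sum_nonneg fun c _ => nonneg a b c).1 hsq a (Finset.mem_univ a)
  have hb := (Finset.sum_eq_zero_iff_of_nonneg fun b _ =>
    Finset.sum_nonneg fun c _ => nonneg a b c).1 ha b (Finset.mem_univ b)
  have hc := (Finset.sum_eq_zero_iff_of_nonneg fun c _ => nonneg a b c).1 hb c (Finset.mem_univ c)
  exact pow_eq_zero_iff two_ne_zero |>.1 hc

namespace DRG

variable {Γ : DRG} {E : ℕ → Matrix Γ.X Γ.X ℝ} {θ : ℕ → ℝ} {q : ℕ → ℕ → ℕ → ℝ} {ts : ℤ → ℝ}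

theorem n_ne_zero (Γ : DRG) : Γ.n ≠ 0 := by
  have := Γ.conn.nonempty
  simp [n]

theorem isSymm_A (Γ : DRG) : Γ.A.IsSymm := by
  ext x y
  simp [A, Ai, SimpleGraph.adj_comm]

theorem IsPrimIdemSeq.mul_A (hE : Γ.IsPrimIdemSeq E θ) {i : ℕ} (hi : i ≤ Γ.d) :
    E i * Γ.A = θ i • E i := by
  obtain ⟨-, -, hmul, hA, -⟩ := hE
  rw [hA, Finset.mul_sum, Finset.sum_eq_single i]
  · rw [Matrix.mul_smul, hmul i i hi hi, if_pos rfl]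
  · intro j hj hji
    rw [Matrix.mul_smul, hmul i j hi (by simpa [Nat.lt_succ_iff] using hj), if_neg hji.symm,
      smul_zero]
  · intro h
    exact absurd (Finset.mem_range.2 (Nat.lt_succ_iff.2 hi)) h

theorem IsPrimIdemSeq.A_mul (hE : Γ.IsPrimIdemSeq E θ) {i : ℕ} (hi : i ≤ Γ.d) :
    Γ.A * E i = θ i • E i := by
  obtain ⟨-, -, hmul, hA, -⟩ := hE
  rw [hA, Finset.sum_mul, Finset.sum_eq_single i]
  · rw [Matrix.smul_mul, hmul i i hi hi, if_pos rfl]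
  · intro j hj hji
    rw [Matrix.smul_mul, hmul j i (by simpa [Nat.lt_succ_iff] using hj) hi, if_neg hji, smul_zero]
  · intro h
    exact absurd (Finset.mem_range.2 (Nat.lt_succ_iff.2 hi)) h

theorem IsPrimIdemSeq.isIdempotentElem (hE : Γ.IsPrimIdemSeq E θ) {i : ℕ} (hi : i ≤ Γ.d) :
    IsIdempotentElem (E i) :=
  (hE.2.2.1 i i hi hi).trans (if_pos rfl)

theorem IsPrimIdemSeq.isSymm (hE : Γ.IsPrimIdemSeq E θ) {i : ℕ} (hi : i ≤ Γ.d) :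
    (E i).IsSymm := by
  have orth (j : ℕ) (hj : j ≤ Γ.d) (hji : j ≠ i) : (E i)ᵀ * E j = 0 := by
    have h₁ : (E i)ᵀ * Γ.A = θ i • (E i)ᵀ := by
      rw [← Matrix.transpose_smul, ← hE.A_mul hi, Matrix.transpose_mul, Γ.isSymm_A.eq]
    have h₂ : θ j • ((E i)ᵀ * E j) = θ i • ((E i)ᵀ * E j) := by
      rw [← Matrix.mul_smul, ← hE.A_mul hj, ← Matrix.mul_assoc, h₁, Matrix.smul_mul]
    have h₃ : (θ j - θ i) • ((E i)ᵀ * E j) = 0 := by rw [sub_smul, h₂, sub_self]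
    exact (smul_eq_zero.1 h₃).resolve_left fun h =>
      hji (hE.2.2.2.2 j i hj hi (sub_eq_zero.1 h))
  have key : (E i)ᵀ = (E i)ᵀ * E i := by
    conv_lhs => rw [← Matrix.mul_one (E i)ᵀ, ← hE.2.1, Finset.mul_sum]
    refine Finset.sum_eq_single i (fun j hj hji => orth j (by simpa [Nat.lt_succ_iff] using hj) hji)
      fun h => absurd (Finset.mem_range.2 (Nat.lt_succ_iff.2 hi)) h
  have key' := congrArg Matrix.transpose key
  rw [Matrix.transpose_mul, Matrix.transpose_transpose, ← key] at key'
  exact key'.symm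

theorem IsDualEigs.apply {F : Matrix Γ.X Γ.X ℝ} (hts : Γ.IsDualEigs F ts) (x y : Γ.X) :
    F x y = Γ.n⁻¹ * ts (Γ.G.dist x y) := by
  rw [hts, Matrix.smul_apply, Matrix.sum_apply, smul_eq_mul, Finset.sum_eq_single (Γ.G.dist x y)]
  · simp [Ai]
  · intro j _ hj
    simp [Ai, hj.symm]
  · intro h
    exact absurd (Finset.mem_range.2 (Nat.lt_succ_iff.2 (Γ.dist_le x y))) h

theorem hatv_apply (x z : Γ.X) : Γ.hatv x z = if z = x then 1 else 0 :=
  Pi.single_apply x 1 z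

theorem mulVec_hatv_apply (F : Matrix Γ.X Γ.X ℝ) (x z : Γ.X) : (F *ᵥ Γ.hatv x) z = F z x := by
  simp [hatv]

theorem plusv_apply (x y z : Γ.X) :
    Γ.plusv x y z = if Γ.G.dist x z = 1 ∧ Γ.G.dist y z = Γ.G.dist x y + 1 then 1 else 0 := by
  simp [plusv, hatv, Finset.sum_apply, Pi.single_apply, sphere, Finset.sum_ite_eq]

/-- A vanishing Krein parameter `q h i j` forces `E i D E h = 0`, where `D` is the diagonal matrix
of a column of `E j`. -/
theorem IsKrein.mul_diagonal_mul_eq_zero (hE : Γ.IsPrimIdemSeq E θ) (hq : Γ.IsKrein E q)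
    {h i j : ℕ} (hh : h ≤ Γ.d) (hi : i ≤ Γ.d) (hj : j ≤ Γ.d) (h0 : q h i j = 0) (y : Γ.X) :
    E i * Matrix.diagonal (E j *ᵥ Γ.hatv y) * E h = 0 := by
  have hprod : Matrix.hadamard (E i) (E j) * E h = 0 := by
    rw [hq i j hi hj, Matrix.smul_mul, Finset.sum_mul, Finset.sum_eq_zero, smul_zero]
    intro l hl
    rw [Matrix.smul_mul, hE.2.2.1 l h (by simpa [Nat.lt_succ_iff] using hl) hh]
    split_ifs with hlh
    · rw [hlh, h0, zero_smul]
    · rw [smul_zero]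
  have hsum : ∑ z, ∑ w, E i z w * E j z w * E h z w = 0 := by
    refine Finset.sum_eq_zero fun z _ => ?_
    have := congrFun (congrFun hprod z) z
    rw [Matrix.mul_apply] at this
    rw [← Matrix.zero_apply (α := ℝ) z z, ← this]
    exact Finset.sum_congr rfl fun w _ => by rw [Matrix.hadamard_apply, (hE.isSymm hh).apply]
  ext a c
  rw [Matrix.mul_apply, Matrix.zero_apply, ← Matrix.sum_mul_mul_eq_zero_of_isSymm_of_isIdempotentElem
    (hE.isSymm hi) (hE.isSymm hj) (hE.isSymm hh) (hE.isIdempotentElem hi) (hE.isIdempotentElem hj)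
    (hE.isIdempotentElem hh) hsum a y c]
  refine Finset.sum_congr rfl fun z _ => ?_
  rw [Matrix.mul_diagonal, mulVec_hatv_apply, (hE.isSymm hj).apply, (hE.isSymm hh).apply]

theorem diagonal_mulVec_idem_zero_mulVec_hatv (hE : Γ.IsPrimIdemSeq E θ)
    (F : Matrix Γ.X Γ.X ℝ) (x y : Γ.X) :
    Matrix.diagonal (F *ᵥ Γ.hatv y) *ᵥ (E 0 *ᵥ Γ.hatv x) = Γ.n⁻¹ • (F *ᵥ Γ.hatv y) := by
  ext z
  rw [Matrix.mulVec_diagonal, mulVec_hatv_apply, mulVec_hatv_apply, hE.1]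
  simp [Jmat, mulVec_hatv_apply, mul_comm]

theorem norton_eq (F : Matrix Γ.X Γ.X ℝ) (u v : Γ.X → ℝ) :
    Γ.norton F u v = F *ᵥ (Matrix.diagonal v *ᵥ u) := by
  rw [norton]
  congr 1
  ext z
  rw [Matrix.mulVec_diagonal, Pi.mul_apply, mul_comm]

theorem norton_comm (F : Matrix Γ.X Γ.X ℝ) (u v : Γ.X → ℝ) :
    Γ.norton F u v = Γ.norton F v u := by
  rw [norton, norton, mul_comm]

/-- Neighbours of `x` lie at distance `0`, `1` or `2` from a neighbour `y` of `x`. -/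
theorem diagonal_mulVec_A_hatv {F : Matrix Γ.X Γ.X ℝ} (hts : Γ.IsDualEigs F ts) {x y : Γ.X}
    (hxy : Γ.G.dist x y = 1) :
    Matrix.diagonal (F *ᵥ Γ.hatv y) *ᵥ (Γ.A *ᵥ Γ.hatv x) =
      Γ.n⁻¹ • ((ts 2 - ts 1) • Γ.plusv x y + ts 1 • (Γ.A *ᵥ Γ.hatv x) +
        (ts 0 - ts 1) • Γ.hatv y) := by
  ext z
  simp only [Matrix.mulVec_diagonal, mulVec_hatv_apply, hts.apply, Pi.smul_apply, Pi.add_apply,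
    plusv_apply, smul_eq_mul, hxy, A, Ai, Matrix.of_apply, hatv_apply]
  rw [SimpleGraph.dist_comm (u := z) (v := x), SimpleGraph.dist_comm (u := z) (v := y)]
  by_cases hxz : Γ.G.dist x z = 1
  · have htri : Γ.G.dist y z ≤ 2 := by
      have := Γ.conn.dist_triangle (u := y) (v := x) (w := z)
      rw [SimpleGraph.dist_comm (u := y) (v := x), hxy, hxz] at this
      exact this
    by_cases hzy : z = y
    · subst hzy
      simp [hxy]
    · have hpos : Γ.G.dist y z ≠ 0 := fun h => hzy ((Γ.conn.dist_eq_zero_iff.1 h).symm)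
      have hcases : Γ.G.dist y z = 1 ∨ Γ.G.dist y z = 2 := by omega
      rcases hcases with h | h <;> simp [h, hxz, hzy]
  · have hzy : z ≠ y := fun h => hxz (h ▸ hxy)
    simp [hxz, hzy]

/-- The Norton product of `E x̂` and `E ŷ` for adjacent `x`, `y`, in asymmetric form. -/
theorem smul_norton_eq_of_dist_eq_one (hE : Γ.IsPrimIdemSeq E θ) (hq : Γ.IsKrein E q)
    (hQ : Γ.IsQPolynomial q) (hts : Γ.IsDualEigs (E 1) ts) {x y : Γ.X}
    (hxy : Γ.G.dist x y = 1) :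
    (Γ.n * (θ 1 - θ 2)) • Γ.norton (E 1) (E 1 *ᵥ Γ.hatv x) (E 1 *ᵥ Γ.hatv y) =
      (ts 2 - ts 1) • (E 1 *ᵥ Γ.plusv x y) + (ts 1 * (θ 1 - θ 2)) • (E 1 *ᵥ Γ.hatv x) +
        (θ 2 - θ 0 + ts 0 - ts 1) • (E 1 *ᵥ Γ.hatv y) := by
  have hd := Γ.d_ge_two
  have h1 : 1 ≤ Γ.d := by omega
  set D := Matrix.diagonal (E 1 *ᵥ Γ.hatv y) with hD
  have expand : E 1 * D * Γ.A - θ 2 • (E 1 * D) =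
      (θ 0 - θ 2) • (E 1 * D * E 0) + (θ 1 - θ 2) • (E 1 * D * E 1) := by
    have hsum : E 1 * D * Γ.A - θ 2 • (E 1 * D) =
        ∑ i ∈ Finset.range (Γ.d + 1), (θ i - θ 2) • (E 1 * D * E i) := by
      conv_lhs => rw [hE.2.2.2.1]; rhs; rw [← Matrix.mul_one (E 1 * D), ← hE.2.1]
      simp_rw [Finset.mul_sum, Finset.smul_sum, ← Finset.sum_sub_distrib, sub_smul,
        Matrix.mul_smul]
    rw [hsum, ← Finset.sum_subset (Finset.range_subset_range.2 (show 3 ≤ Γ.d + 1 by omega))]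
    · simp [Finset.sum_range_succ]
    · intro i hi hi3
      have hid : i ≤ Γ.d := by simpa [Nat.lt_succ_iff] using hi
      have hi3' : 1 + 1 < i := by simp at hi3; omega
      rw [hq.mul_diagonal_mul_eq_zero hE hid h1 h1 ((hQ i 1 1 hid h1 h1).1 (Or.inl hi3')),
        smul_zero]
  have happ := congrArg (· *ᵥ Γ.hatv x) expand
  have hDx : D *ᵥ Γ.hatv x = (Γ.n⁻¹ * ts 1) • Γ.hatv x := by
    ext z
    simp only [hD, Matrix.mulVec_diagonal, mulVec_hatv_apply, hts.apply, Pi.smul_apply, hatv_apply,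
      smul_eq_mul]
    split_ifs with hz
    · rw [hz, hxy]; simp
    · simp
  simp only [Matrix.sub_mulVec, Matrix.add_mulVec, Matrix.smul_mulVec, ← Matrix.mulVec_mulVec]
    at happ
  rw [hDx, hD, diagonal_mulVec_idem_zero_mulVec_hatv hE,
    diagonal_mulVec_A_hatv hts hxy, ← norton_eq] at happ
  simp only [Matrix.mulVec_smul, Matrix.mulVec_add] at happ
  rw [Matrix.mulVec_mulVec, hE.mul_A h1, Matrix.mulVec_mulVec, (hE.isIdempotentElem h1).eq,
    Matrix.smul_mulVec] at happ
  have hn := Γ.n_ne_zero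
  ext z
  have hz := congrFun happ z
  simp only [Pi.smul_apply, Pi.add_apply, Pi.sub_apply, smul_eq_mul] at hz ⊢
  field_simp at hz
  linear_combination -hz

/-- Entries of `E x⁺_y`, at a vertex whose distance to all of `Γ(x) ∩ Γ₂(y)` is constant. -/
theorem mulVec_plusv_apply {F : Matrix Γ.X Γ.X ℝ} (hts : Γ.IsDualEigs F ts) {x y w : Γ.X}
    (hxy : Γ.G.dist x y = 1) {m : ℕ}
    (hw : ∀ z, Γ.G.dist x z = 1 → Γ.G.dist y z = 2 → Γ.G.dist w z = m) :
    (F *ᵥ Γ.plusv x y) w = Γ.n⁻¹ * ts m * Γ.b 1 := by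
  have hb : Γ.b 1 = ∑ z, Γ.plusv x y z := by
    rw [b, ← Γ.dist_regular 1 1 (1 + 1) x y hxy]
    simp [plusv_apply, hxy]
  rw [hb, Finset.mul_sum, Matrix.mulVec, dotProduct]
  refine Finset.sum_congr rfl fun z _ => ?_
  rw [plusv_apply, hxy]
  split_ifs with hz
  · rw [hts.apply, hw z hz.1 hz.2]
  · simp

/-- The scalar relation obtained by comparing both asymmetric forms of the Norton product. -/
theorem dual_eigenvalue_relation (hE : Γ.IsPrimIdemSeq E θ) (hq : Γ.IsKrein E q)
    (hQ : Γ.IsQPolynomial q) (hts : Γ.IsDualEigs (E 1) ts) {x y : Γ.X}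
    (hxy : Γ.G.dist x y = 1) :
    (ts 1 * (θ 1 - θ 2) - (θ 2 - θ 0 + ts 0 - ts 1)) * (ts 0 - ts 1) =
      (ts 2 - ts 1) ^ 2 * Γ.b 1 := by
  have hyx : Γ.G.dist y x = 1 := by rw [SimpleGraph.dist_comm, hxy]
  have h := smul_norton_eq_of_dist_eq_one hE hq hQ hts hxy
  rw [norton_comm, smul_norton_eq_of_dist_eq_one hE hq hQ hts hyx] at h
  have hx := congrFun h x
  simp only [Pi.smul_apply, Pi.add_apply, smul_eq_mul, mulVec_hatv_apply, hts.apply, hxy,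
    SimpleGraph.dist_self, mulVec_plusv_apply hts hxy (fun z hz _ => hz),
    mulVec_plusv_apply hts hyx (fun z _ hz => hz)] at hx
  have hn := Γ.n_ne_zero
  field_simp at hx
  push_cast at hx
  linear_combination -hx

end DRG

/-- Corollary 4.6(i): symmetric form, `i = 1` case. -/
theorem DRG.norton_product_symmetric_dist_one (Γ : DRG) (E : ℕ → Matrix Γ.X Γ.X ℝ) (θ : ℕ → ℝ)
    (hE : Γ.IsPrimIdemSeq E θ)
    (q : ℕ → ℕ → ℕ → ℝ) (hq : Γ.IsKrein E q) (hQ : Γ.IsQPolynomial q)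
    (ts : ℤ → ℝ) (hts : Γ.IsDualEigs (E 1) ts) (hts' : Γ.DualDistinct ts) (x y : Γ.X)
    (hxy : Γ.G.dist x y = 1) :
    Γ.norton (E 1) (E 1 *ᵥ Γ.hatv x) (E 1 *ᵥ Γ.hatv y) =
      (Γ.n * (θ 1 - θ 2))⁻¹ •
        ((ts 2 - ts 1) • Γ.Bvec (E 1) ts x y +
          (θ 2 - θ 0 + ts 0 - ts 1) • (E 1 *ᵥ Γ.hatv x + E 1 *ᵥ Γ.hatv y)) := by
  have hd := Γ.d_ge_two
  have hθ : θ 1 - θ 2 ≠ 0 := fun h => by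
    have := hE.2.2.2.2 1 2 (by omega) hd (sub_eq_zero.1 h)
    omega
  have hts01 : ts 0 - ts 1 ≠ 0 := fun h => by
    have := hts' 0 1 (by omega) (by omega) (by exact_mod_cast sub_eq_zero.1 h)
    omega
  rw [eq_inv_smul_iff₀ (mul_ne_zero Γ.n_ne_zero hθ),
    smul_norton_eq_of_dist_eq_one hE hq hQ hts hxy]
  have hrel := dual_eigenvalue_relation hE hq hQ hts hxy
  have hcoef : ts 1 * (θ 1 - θ 2) = θ 2 - θ 0 + ts 0 - ts 1 -
      (ts 2 - ts 1) * (Γ.b 1 * ((ts 1 - ts 2) / (ts 0 - ts 1))) := by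
    field_simp
    linear_combination hrel
  ext z
  simp only [Bvec, hxy, Pi.smul_apply, Pi.add_apply, Pi.sub_apply, smul_eq_mul, hcoef,
    Nat.cast_one, one_add_one_eq_two]
  ring
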